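/- arXiv:1611.09018 — 2 statements merged into one kernel-verified Lean document; each statement's English description precedes it below -/
import Mathlib

section
/- In the ring ℚ[x][[t]], the following identity holds: (1 + Σ_{n≥1} (t^{3n}/(3n)!) · Σ_{σ ∈ SF_n} x^{risB(σ)}) · (1 − Σ_{n≥1} (t^{3n}/(3n)!) (x−1)^{n−1} · IBF_n) = 1. -/
/-- `SF n`: binary-shrub-forest permutations of size `n`, modeled as permutations of
`Fin (3*n)` (0-based; position `p` corresponds to 1-based position `p+1`):
for every `0 ≤ i ≤ n-1`, `σ(3i+1) < σ(3i+2)` and `σ(3i+1) < σ(3i+3)` (1-based). -/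
def SF (n : ℕ) : Finset (Equiv.Perm (Fin (3*n))) :=
  Finset.univ.filter fun σ =>
    ∀ i < n, ∃ h : 3*i+2 < 3*n,
      σ ⟨3*i, by omega⟩ < σ ⟨3*i+1, by omega⟩ ∧ σ ⟨3*i, by omega⟩ < σ ⟨3*i+2, h⟩

/-- 0-based shrub index `j` is a base rise (1-based rise index `i = j+1`):
`σ(3i-2) < σ(3i+1)` in 1-based terms. -/
def baseRise (n : ℕ) (σ : Equiv.Perm (Fin (3*n))) (j : ℕ) : Prop :=
  ∃ h : 3*j+3 < 3*n, σ ⟨3*j, by omega⟩ < σ ⟨3*j+3, h⟩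

instance (n : ℕ) (σ : Equiv.Perm (Fin (3*n))) : DecidablePred (baseRise n σ) :=
  fun _ => by unfold baseRise; infer_instance

/-- `risB σ`: the number of base rises of `σ`. -/
def risB (n : ℕ) (σ : Equiv.Perm (Fin (3*n))) : ℕ :=
  ((Finset.range n).filter (baseRise n σ)).card

/-- `IBF n`: the number of `σ ∈ SF n` for which every `i ∈ {1,…,n-1}` is a base rise. -/
def IBF (n : ℕ) : ℕ := ((SF n).filter fun σ => ∀ j < n - 1, baseRise n σ j).card

/-- The EGF `1 + Σ_{n≥1} (t^(3n)/(3n)!) Σ_{σ ∈ SF n} x^(risB σ)` in `ℚ[x][[t]]`. -/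
noncomputable def RBser : PowerSeries (Polynomial ℚ) :=
  PowerSeries.mk fun m =>
    if m = 0 then 1
    else if m % 3 = 0 then
      Polynomial.C ((m.factorial : ℚ)⁻¹) * ∑ σ ∈ SF (m / 3), Polynomial.X ^ risB (m / 3) σ
    else 0

/-- The series `1 - Σ_{n≥1} (t^(3n)/(3n)!) (x-1)^(n-1) ⋅ IBF n` in `ℚ[x][[t]]`. -/
noncomputable def GBser : PowerSeries (Polynomial ℚ) :=
  PowerSeries.mk fun m =>
    if m = 0 then 1
    else if m % 3 = 0 then
      -(Polynomial.C ((m.factorial : ℚ)⁻¹) * (Polynomial.X - 1) ^ (m / 3 - 1) *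
        (IBF (m / 3) : Polynomial ℚ))
    else 0

open Finset

section Patterns

/-- The one-line word of a permutation of `Fin N`, extended by zero to all of `ℕ`. -/
def permWord {N : ℕ} (σ : Equiv.Perm (Fin N)) (p : ℕ) : ℕ :=
  if h : p < N then σ ⟨p, h⟩ else 0

/-- `F f` depends only on the relative order of the first `a` letters of the word `f`. -/
def DependsOnPattern {R : Type*} (a : ℕ) (F : (ℕ → ℕ) → R) : Prop :=
  ∀ f g : ℕ → ℕ, (∀ i < a, ∀ j < a, (f i < f j ↔ g i < g j)) → F f = F g

/-- Extend a finite word by zero. -/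
def extendWord {a : ℕ} (f : Fin a → ℕ) (p : ℕ) : ℕ :=
  if h : p < a then f ⟨p, h⟩ else 0

lemma sum_perm_extendWord_comp {R : Type*} [AddCommMonoid R] {a : ℕ} {F : (ℕ → ℕ) → R}
    (hF : DependsOnPattern a F) (f : Fin a → ℕ) (hf : Function.Injective f) :
    ∑ α : Equiv.Perm (Fin a), F (extendWord (f ∘ α)) =
      ∑ α : Equiv.Perm (Fin a), F (permWord α) := by
  have hmono : StrictMono (f ∘ Tuple.sort f) :=
    (Tuple.monotone_sort f).strictMono_of_injective (hf.comp (Tuple.sort f).injective)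
  rw [← Equiv.sum_comp (Equiv.mulLeft (Tuple.sort f))]
  refine sum_congr rfl fun α _ => hF _ _ fun i hi j hj => ?_
  have h := hmono.lt_iff_lt (a := α ⟨i, hi⟩) (b := α ⟨j, hj⟩)
  simpa [extendWord, permWord, hi, hj] using h

lemma sum_perm_mul_sum_perm {R : Type*} [CommRing R] {a b : ℕ} {F G : (ℕ → ℕ) → R}
    (hF : DependsOnPattern a F) (hG : DependsOnPattern b G) :
    (a.factorial * b.factorial : R) *
        ∑ σ : Equiv.Perm (Fin (a + b)), F (permWord σ) * G (fun p => permWord σ (p + a)) =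
      (a + b).factorial * ((∑ α : Equiv.Perm (Fin a), F (permWord α)) *
        ∑ β : Equiv.Perm (Fin b), G (permWord β)) := by
  let h (α : Equiv.Perm (Fin a)) (β : Equiv.Perm (Fin b)) : Equiv.Perm (Fin (a + b)) :=
    finSumFinEquiv.permCongr (Equiv.sumCongr α β)
  have hl (α β) (i : Fin a) : h α β (Fin.castAdd b i) = Fin.castAdd b (α i) := by
    simp [h, Equiv.permCongr_apply]
  have hr (α β) (i : Fin b) : h α β (Fin.natAdd a i) = Fin.natAdd a (β i) := by
    simp [h, Equiv.permCongr_apply]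
  have key (σ : Equiv.Perm (Fin (a + b))) (α : Equiv.Perm (Fin a))
      (β : Equiv.Perm (Fin b)) :
      F (permWord (σ * h α β)) * G (fun p => permWord (σ * h α β) (p + a)) =
        F (extendWord ((fun i => (σ (Fin.castAdd b i) : ℕ)) ∘ α)) *
        G (extendWord ((fun i => (σ (Fin.natAdd a i) : ℕ)) ∘ β)) := by
    have el (i) (hi : i < a) : permWord (σ * h α β) i =
        extendWord ((fun i => (σ (Fin.castAdd b i) : ℕ)) ∘ α) i := by
      have := hl α β ⟨i, hi⟩
      simp only [Fin.castAdd_mk] at this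
      simp [permWord, extendWord, hi, show i < a + b by omega, this]
    have er (i) (hi : i < b) : permWord (σ * h α β) (i + a) =
        extendWord ((fun i => (σ (Fin.natAdd a i) : ℕ)) ∘ β) i := by
      have := hr α β ⟨i, hi⟩
      simp only [Fin.natAdd_mk] at this
      simp [permWord, extendWord, hi, add_comm i a, this]
    congr 1
    · exact hF _ _ fun i hi j hj => by rw [el i hi, el j hj]
    · exact hG _ _ fun i hi j hj => by rw [er i hi, er j hj]
  calc
    _ = ∑ α : Equiv.Perm (Fin a), ∑ β : Equiv.Perm (Fin b), ∑ σ : Equiv.Perm (Fin (a + b)),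
          F (permWord (σ * h α β)) * G (fun p => permWord (σ * h α β) (p + a)) := by
      have (α : Equiv.Perm (Fin a)) (β : Equiv.Perm (Fin b)) : ∑ σ : Equiv.Perm (Fin (a + b)),
          F (permWord (σ * h α β)) * G (fun p => permWord (σ * h α β) (p + a)) =
          ∑ σ : Equiv.Perm (Fin (a + b)), F (permWord σ) * G (fun p => permWord σ (p + a)) :=
        Equiv.sum_comp (Equiv.mulRight (h α β))
          (fun σ => F (permWord σ) * G (fun p => permWord σ (p + a)))
      simp [this, Fintype.card_perm, mul_assoc]
    _ = ∑ σ : Equiv.Perm (Fin (a + b)),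
          (∑ α : Equiv.Perm (Fin a), F (extendWord ((fun i => (σ (Fin.castAdd b i) : ℕ)) ∘ α))) *
          ∑ β : Equiv.Perm (Fin b), G (extendWord ((fun i => (σ (Fin.natAdd a i) : ℕ)) ∘ β)) := by
      simp_rw [key, sum_mul_sum]
      rw [sum_comm (s := (univ : Finset (Equiv.Perm (Fin (a + b)))))]
      exact sum_congr rfl fun α _ => sum_comm
    _ = _ := by
      have (σ : Equiv.Perm (Fin (a + b))) := sum_perm_extendWord_comp hF
        (fun i => (σ (Fin.castAdd b i) : ℕ))
        (Fin.val_injective.comp (σ.injective.comp (Fin.castAdd_injective a b)))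
      simp_rw [this]
      have (σ : Equiv.Perm (Fin (a + b))) := sum_perm_extendWord_comp hG
        (fun i => (σ (Fin.natAdd a i) : ℕ))
        (Fin.val_injective.comp (σ.injective.comp (Fin.natAdd_injective b a)))
      simp_rw [this]
      simp [Fintype.card_perm]

end Patterns

section Weights

variable {R : Type*} [CommRing R]

/-- The weight of the first `n` shrubs of a word: zero unless they are all increasing shrubs, and
otherwise the product over adjacent shrubs of `u` for a base rise and `v` for a non-rise. -/
def shrubWeight (u v : R) (n : ℕ) (f : ℕ → ℕ) : R :=
  (∏ i ∈ range n, if f (3 * i) < f (3 * i + 1) ∧ f (3 * i) < f (3 * i + 2) then 1 else 0) *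
    ∏ j ∈ range (n - 1), if f (3 * j) < f (3 * j + 3) then u else v

lemma shrubWeight_zero (u v : R) (f : ℕ → ℕ) : shrubWeight u v 0 f = 1 := by
  simp [shrubWeight]

lemma shrubWeight_one (u v : R) (f : ℕ → ℕ) :
    shrubWeight u v 1 f = if f 0 < f 1 ∧ f 0 < f 2 then 1 else 0 := by
  simp [shrubWeight]

lemma shrubWeight_add_two (u v : R) (n : ℕ) (f : ℕ → ℕ) :
    shrubWeight u v (n + 2) f = shrubWeight u v 1 f * (if f 0 < f 3 then u else v) *
      shrubWeight u v (n + 1) (fun p => f (p + 3)) := by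
  rw [shrubWeight_one]
  simp only [shrubWeight, show n + 2 - 1 = n + 1 by omega, show n + 1 - 1 = n by omega]
  rw [prod_range_succ' _ (n + 1),
    prod_range_succ' (fun j => if f (3 * j) < f (3 * j + 3) then u else v) n]
  simp only [mul_add_one, add_right_comm _ 3, mul_zero, zero_add]
  ring

lemma dependsOnPattern_shrubWeight (u v : R) (n : ℕ) :
    DependsOnPattern (3 * n) (shrubWeight u v n) := by
  intro f g h
  unfold shrubWeight
  congr 1
  · refine prod_congr rfl fun i hi => ?_
    rw [mem_range] at hi
    simp only [h (3 * i) (by omega) (3 * i + 1) (by omega),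
      h (3 * i) (by omega) (3 * i + 2) (by omega)]
  · refine prod_congr rfl fun i hi => ?_
    rw [mem_range] at hi
    simp only [h (3 * i) (by omega) (3 * i + 3) (by omega)]

/-- Expand every adjacency weight as `u + 1` or `v + 1` and cut at the first chosen `1`. -/
lemma shrubWeight_add_one (u v : R) (n : ℕ) (f : ℕ → ℕ) :
    shrubWeight (u + 1) (v + 1) (n + 1) f = ∑ k ∈ range (n + 1),
      shrubWeight u v (k + 1) f *
        shrubWeight (u + 1) (v + 1) (n - k) (fun p => f (p + 3 * (k + 1))) := by
  induction n generalizing f with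
  | zero => simp [shrubWeight_one, shrubWeight_zero]
  | succ n ih =>
    have hstep : shrubWeight (u + 1) (v + 1) (n + 2) f =
        shrubWeight u v 1 f * (if f 0 < f 3 then u else v) *
          shrubWeight (u + 1) (v + 1) (n + 1) (fun p => f (p + 3)) +
        shrubWeight u v 1 f * shrubWeight (u + 1) (v + 1) (n + 1) (fun p => f (p + 3)) := by
      rw [shrubWeight_add_two, shrubWeight_one, shrubWeight_one]
      split_ifs <;> ring
    rw [hstep, sum_range_succ' _ (n + 1)]
    congr 1
    rw [ih, mul_sum]
    refine sum_congr rfl fun k _ => ?_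
    rw [shrubWeight_add_two, Nat.add_sub_add_right]
    simp only [show ∀ p, p + 3 * (k + 1 + 1) = p + 3 * (k + 1) + 3 by intro; ring]
    ring

/-- The total weight of all permutations of `Fin (3 * n)`. -/
def shrubSum (u v : R) (n : ℕ) : R :=
  ∑ σ : Equiv.Perm (Fin (3 * n)), shrubWeight u v n (permWord σ)

lemma shrubSum_split (u v u' v' : R) {k l n : ℕ} (h : k + l = n) :
    ((3 * k).factorial * (3 * l).factorial : R) *
        ∑ σ : Equiv.Perm (Fin (3 * n)), shrubWeight u v k (permWord σ) *
          shrubWeight u' v' l (fun p => permWord σ (p + 3 * k)) =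
      (3 * n).factorial * (shrubSum u v k * shrubSum u' v' l) := by
  obtain ⟨N, hN⟩ : ∃ N, N = 3 * n := ⟨_, rfl⟩
  have hN' : N = 3 * k + 3 * l := by omega
  rw [← hN]
  subst hN'
  exact sum_perm_mul_sum_perm (dependsOnPattern_shrubWeight u v k)
    (dependsOnPattern_shrubWeight u' v' l)

lemma mem_SF_iff {n : ℕ} (σ : Equiv.Perm (Fin (3 * n))) :
    σ ∈ SF n ↔ ∀ i ∈ range n, permWord σ (3 * i) < permWord σ (3 * i + 1) ∧
      permWord σ (3 * i) < permWord σ (3 * i + 2) := by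
  simp only [SF, mem_filter, mem_univ, true_and, mem_range]
  refine forall₂_congr fun i hi => ?_
  have h0 : 3 * i < 3 * n := by omega
  have h1 : 3 * i + 1 < 3 * n := by omega
  have h2 : 3 * i + 2 < 3 * n := by omega
  simp [permWord, h0, h1, h2]

lemma baseRise_iff {n : ℕ} (σ : Equiv.Perm (Fin (3 * n))) (j : ℕ) :
    baseRise n σ j ↔ j < n - 1 ∧ permWord σ (3 * j) < permWord σ (3 * j + 3) := by
  unfold baseRise
  by_cases hj : j < n - 1
  · have h0 : 3 * j < 3 * n := by omega
    have h1 : 3 * j + 3 < 3 * n := by omega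
    simp [permWord, h0, h1, hj]
  · have h1 : ¬ 3 * j + 3 < 3 * n := by omega
    simp [h1, hj]

lemma shrubWeight_permWord (u v : R) {n : ℕ} (σ : Equiv.Perm (Fin (3 * n))) :
    shrubWeight u v n (permWord σ) = if σ ∈ SF n then
      ∏ j ∈ range (n - 1), if baseRise n σ j then u else v else 0 := by
  have h : (∏ j ∈ range (n - 1), if baseRise n σ j then u else v) =
      ∏ j ∈ range (n - 1), if permWord σ (3 * j) < permWord σ (3 * j + 3) then u else v :=
    prod_congr rfl fun j hj => by simp [baseRise_iff, mem_range.1 hj]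
  rw [h, shrubWeight, prod_ite_zero]
  simp only [mem_SF_iff, prod_const_one, ite_mul, one_mul, zero_mul]

lemma sum_SF_pow_risB (u : R) (n : ℕ) : ∑ σ ∈ SF n, u ^ risB n σ = shrubSum u 1 n := by
  simp_rw [shrubSum, shrubWeight_permWord, sum_ite_mem, univ_inter]
  refine sum_congr rfl fun σ _ => ?_
  rw [prod_ite, prod_const, prod_const_one, mul_one, risB]
  congr 2
  ext j
  simp only [mem_filter, mem_range, baseRise_iff]
  omega

lemma pow_mul_IBF (u : R) (n : ℕ) : u ^ (n - 1) * IBF n = shrubSum u 0 n := by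
  simp_rw [shrubSum, shrubWeight_permWord, sum_ite_mem, univ_inter, prod_ite_zero, IBF]
  simp [← sum_filter, mul_comm]

end Weights

lemma coeff_RBser (n : ℕ) : PowerSeries.coeff (3 * n) RBser =
    Polynomial.C (((3 * n).factorial : ℚ)⁻¹) * shrubSum Polynomial.X 1 n := by
  rcases Nat.eq_zero_or_pos n with rfl | hn
  · simp [RBser, shrubSum, shrubWeight_zero]
  · simp [RBser, hn.ne', sum_SF_pow_risB]

lemma coeff_GBser_zero : PowerSeries.coeff 0 GBser = 1 := by
  simp [GBser]

lemma coeff_GBser_succ (n : ℕ) : PowerSeries.coeff (3 * (n + 1)) GBser =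
    -(Polynomial.C (((3 * (n + 1)).factorial : ℚ)⁻¹) *
      shrubSum (Polynomial.X - 1) 0 (n + 1)) := by
  rw [← pow_mul_IBF]
  simp [GBser, mul_assoc]

lemma coeff_RBser_succ (n : ℕ) : PowerSeries.coeff (3 * (n + 1)) RBser =
    -∑ k ∈ range (n + 1), PowerSeries.coeff (3 * (k + 1)) GBser *
      PowerSeries.coeff (3 * (n - k)) RBser := by
  have h := fun σ : Equiv.Perm (Fin (3 * (n + 1))) =>
    shrubWeight_add_one (Polynomial.X - 1 : Polynomial ℚ) 0 n (permWord σ)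
  simp only [sub_add_cancel, zero_add] at h
  rw [coeff_RBser, shrubSum, sum_congr rfl fun σ _ => h σ, sum_comm, mul_sum, ← sum_neg_distrib]
  refine sum_congr rfl fun k hk => ?_
  rw [mem_range] at hk
  rw [coeff_GBser_succ, coeff_RBser, neg_mul, neg_neg]
  have hs := shrubSum_split (Polynomial.X - 1 : Polynomial ℚ) 0 Polynomial.X 1
    (show (k + 1) + (n - k) = n + 1 by omega)
  have hC (m : ℕ) : Polynomial.C ((m.factorial : ℚ)⁻¹) * (m.factorial : Polynomial ℚ) = 1 := by
    rw [← Polynomial.C_eq_natCast, ← Polynomial.C_mul,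
      inv_mul_cancel₀ (by exact_mod_cast m.factorial_ne_zero), Polynomial.C_1]
  have ha := hC (3 * (k + 1))
  have hb := hC (3 * (n - k))
  have hc := hC (3 * (n + 1))
  generalize Polynomial.C (((3 * (k + 1)).factorial : ℚ)⁻¹) = A at *
  generalize Polynomial.C (((3 * (n - k)).factorial : ℚ)⁻¹) = B at *
  generalize Polynomial.C (((3 * (n + 1)).factorial : ℚ)⁻¹) = C at *
  generalize ∑ σ : Equiv.Perm (Fin (3 * (n + 1))),
    shrubWeight (Polynomial.X - 1 : Polynomial ℚ) 0 (k + 1) (permWord σ) *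
      shrubWeight Polynomial.X 1 (n - k) (fun p => permWord σ (p + 3 * (k + 1))) = S at *
  generalize shrubSum (Polynomial.X - 1 : Polynomial ℚ) 0 (k + 1) = P at *
  generalize shrubSum (Polynomial.X : Polynomial ℚ) 1 (n - k) = Q at *
  linear_combination A * B * C * hs - C * S * ha * (B * ((3 * (n - k)).factorial : Polynomial ℚ)) -
    C * S * hb + A * B * P * Q * hc

theorem RBser_mul : RBser * GBser = 1 := by
  have hR (m : ℕ) (hm : ¬ 3 ∣ m) : PowerSeries.coeff m RBser = 0 := by
    have h0 : m ≠ 0 := by rintro rfl; simp at hm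
    simp [RBser, h0, show ¬ m % 3 = 0 by omega]
  have hG (m : ℕ) (hm : ¬ 3 ∣ m) : PowerSeries.coeff m GBser = 0 := by
    have h0 : m ≠ 0 := by rintro rfl; simp at hm
    simp [GBser, h0, show ¬ m % 3 = 0 by omega]
  rw [mul_comm]
  ext1 m
  rw [PowerSeries.coeff_mul, PowerSeries.coeff_one]
  by_cases hm : 3 ∣ m
  · obtain ⟨n, rfl⟩ := hm
    have hsum : ∑ p ∈ antidiagonal (3 * n),
        PowerSeries.coeff p.1 GBser * PowerSeries.coeff p.2 RBser =
        ∑ p ∈ antidiagonal n,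
          PowerSeries.coeff (3 * p.1) GBser * PowerSeries.coeff (3 * p.2) RBser := by
      symm
      refine sum_of_injOn (fun p => (3 * p.1, 3 * p.2)) ?_ ?_ ?_ ?_
      · rintro ⟨a, b⟩ _ ⟨c, d⟩ _ h
        simpa using h
      · rintro ⟨a, b⟩ h
        simp only [mem_coe, HasAntidiagonal.mem_antidiagonal] at h ⊢
        omega
      · rintro ⟨a, b⟩ h h'
        by_cases ha : 3 ∣ a
        · obtain ⟨c, rfl⟩ := ha
          rw [HasAntidiagonal.mem_antidiagonal] at h
          refine absurd ⟨(c, n - c), ?_, ?_⟩ h'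
          · simp only [mem_coe, HasAntidiagonal.mem_antidiagonal]
            omega
          · simp only [Prod.mk.injEq, true_and]
            omega
        · simp [hG a ha]
      · exact fun _ _ => rfl
    rw [hsum]
    cases n with
    | zero => simp [coeff_GBser_zero, RBser]
    | succ n =>
      rw [Nat.sum_antidiagonal_eq_sum_range_succ
        (fun i j => PowerSeries.coeff (3 * i) GBser * PowerSeries.coeff (3 * j) RBser),
        sum_range_succ']
      simp [coeff_GBser_zero, coeff_RBser_succ]
  · rw [if_neg (by rintro rfl; simp at hm)]
    refine sum_eq_zero fun p hp => ?_
    rw [HasAntidiagonal.mem_antidiagonal] at hp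
    by_cases ha : 3 ∣ p.1
    · rw [hR p.2 (by omega), mul_zero]
    · rw [hG p.1 ha, zero_mul]
end

section
/- For every n ≥ 1, ILF_n equals the number of Kreweras paths of length 3n, i.e., the number of sequences (p_1,…,p_{3n}) of steps, each step belonging to {(1,1), (−1,0), (0,−1)} ⊆ ℤ×ℤ, whose total sum is (0,0) and all of whose partial sums p_1 + ⋯ + p_i (1 ≤ i ≤ 3n) have both coordinates ≥ 0. -/
/-- 0-based shrub index `j` is a lexicographic rise (1-based rise index `i = j+1`):
`σ(3i-2) < σ(3i+1)`, `σ(3i-1) < σ(3i+2)` and `σ(3i) < σ(3i+3)` in 1-based terms. -/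
def lexRise (n : ℕ) (σ : Equiv.Perm (Fin (3*n))) (j : ℕ) : Prop :=
  ∃ h : 3*j+5 < 3*n,
    σ ⟨3*j, by omega⟩ < σ ⟨3*j+3, by omega⟩ ∧
    σ ⟨3*j+1, by omega⟩ < σ ⟨3*j+4, by omega⟩ ∧
    σ ⟨3*j+2, by omega⟩ < σ ⟨3*j+5, h⟩

instance (n : ℕ) (σ : Equiv.Perm (Fin (3*n))) : DecidablePred (lexRise n σ) :=
  fun _ => by unfold lexRise; infer_instance

/-- `risL σ`: the number of lexicographic rises of `σ`. -/
def risL (n : ℕ) (σ : Equiv.Perm (Fin (3*n))) : ℕ :=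
  ((Finset.range n).filter (lexRise n σ)).card

/-- `ILF n`: the number of `σ ∈ SF n` for which every `i ∈ {1,…,n-1}` is a
lexicographic rise. -/
def ILF (n : ℕ) : ℕ := ((SF n).filter fun σ => ∀ j < n - 1, lexRise n σ j).card

/-- The three Kreweras steps `(1,1)`, `(-1,0)`, `(0,-1)` in `ℤ × ℤ`. -/
def KSteps : Finset (ℤ × ℤ) := {(1,1), (-1,0), (0,-1)}

/-- Kreweras paths of length `m`: sequences of `m` steps from `KSteps` whose total sum
is `(0,0)` and all of whose partial sums have both coordinates `≥ 0`. -/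
def kreweras (m : ℕ) : Finset (Fin m → KSteps) :=
  Finset.univ.filter fun p =>
    (∑ i, (p i : ℤ × ℤ)) = 0 ∧
    ∀ i : Fin m, 0 ≤ (∑ j ∈ Finset.univ.filter (· ≤ i), (p j : ℤ × ℤ)).1 ∧
                 0 ≤ (∑ j ∈ Finset.univ.filter (· ≤ i), (p j : ℤ × ℤ)).2

/-- Positions of `Fin (3 * n)` as pairs (shrub, place inside the shrub). -/
def shrubEquiv (n : ℕ) : Fin n × Fin 3 ≃ Fin (3 * n) where
  toFun x := ⟨3 * x.1 + x.2, by omega⟩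
  invFun v := (⟨v / 3, by omega⟩, ⟨v % 3, by omega⟩)
  left_inv := by
    rintro ⟨i, c⟩
    ext <;> simp <;> omega
  right_inv v := by
    ext
    simp
    omega

/-- The Kreweras steps, numbered by `Fin 3`. -/
def stepOf (c : Fin 3) : KSteps :=
  ⟨![(1, 1), (-1, 0), (0, -1)] c, by fin_cases c <;> simp [KSteps]⟩

theorem stepOf_bijective : Function.Bijective stepOf := by
  constructor
  · intro a b h
    have h' := congrArg Subtype.val h
    revert h'
    fin_cases a <;> fin_cases b <;> simp [stepOf]
  · rintro ⟨x, hx⟩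
    simp only [KSteps, Finset.mem_insert, Finset.mem_singleton] at hx
    rcases hx with rfl | rfl | rfl
    exacts [⟨0, rfl⟩, ⟨1, rfl⟩, ⟨2, rfl⟩]

theorem sum_stepOf {ι : Type*} (S : Finset ι) (f : ι → Fin 3) :
    ∑ v ∈ S, (stepOf (f v) : ℤ × ℤ) =
      (((S.filter (f · = 0)).card : ℤ) - (S.filter (f · = 1)).card,
        ((S.filter (f · = 0)).card : ℤ) - (S.filter (f · = 2)).card) := by
  have key : ∀ c : Fin 3, (stepOf c : ℤ × ℤ) =
      ((if c = 0 then 1 else 0) - (if c = 1 then 1 else 0),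
        (if c = 0 then 1 else 0) - (if c = 2 then 1 else 0)) := by
    intro c
    fin_cases c <;> simp [stepOf]
  simp only [key, Finset.card_filter]
  ext <;> simp [Prod.fst_sum, Prod.snd_sum]

/-- Words in three letters, equally often used, in which every prefix has at least as many
letters `0` as letters `c`, for every `c`. -/
def ballotWords (n : ℕ) : Finset (Fin (3 * n) → Fin 3) :=
  Finset.univ.filter fun f =>
    (∀ c, (Finset.univ.filter (f · = c)).card = n) ∧
    ∀ k c, (Finset.univ.filter fun v => v ≤ k ∧ f v = c).card ≤
      (Finset.univ.filter fun v => v ≤ k ∧ f v = 0).card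

theorem card_fibers_fin_three {ι : Type*} [Fintype ι] (f : ι → Fin 3) :
    (Finset.univ.filter (f · = 0)).card + (Finset.univ.filter (f · = 1)).card +
      (Finset.univ.filter (f · = 2)).card = Fintype.card ι := by
  have h := Finset.card_eq_sum_card_fiberwise (f := f) (s := Finset.univ) (t := Finset.univ)
    (fun _ _ => by simp)
  rw [Fin.sum_univ_three] at h
  exact h.symm

theorem card_kreweras (n : ℕ) : (kreweras (3 * n)).card = (ballotWords n).card := by
  symm
  refine Finset.card_equiv
    ((Equiv.refl (Fin (3 * n))).arrowCongr (Equiv.ofBijective stepOf stepOf_bijective)) fun f => ?_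
  have h := card_fibers_fin_three f
  rw [Fintype.card_fin] at h
  simp only [ballotWords, kreweras, Finset.mem_filter, Finset.mem_univ, true_and,
    Equiv.arrowCongr_apply, Equiv.refl_symm, Equiv.coe_refl, Function.comp_apply, id_eq,
    Equiv.ofBijective_apply, sum_stepOf, Finset.filter_filter, Prod.mk_eq_zero,
    Fin.forall_fin_succ (n := 2), Fin.forall_fin_two, Fin.succ_zero_eq_one, Fin.succ_one_eq_two,
    sub_nonneg, Nat.cast_le, le_refl]
  refine and_congr ?_ Iff.rfl
  omega

/-- The permutations counted by `ILF`, as linear extensions. -/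
def shrubExtensions (n : ℕ) : Finset (Equiv.Perm (Fin (3 * n))) :=
  (SF n).filter fun σ => ∀ j < n - 1, lexRise n σ j

theorem mem_shrubExtensions {n : ℕ} {σ : Equiv.Perm (Fin (3 * n))} :
    σ ∈ shrubExtensions n ↔
      (∀ c, StrictMono fun i => σ (shrubEquiv n (i, c))) ∧
        ∀ i c, σ (shrubEquiv n (i, 0)) ≤ σ (shrubEquiv n (i, c)) := by
  simp only [shrubExtensions, SF, Finset.mem_filter, Finset.mem_univ, true_and]
  constructor
  · rintro ⟨hs, hr⟩
    constructor
    · intro c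
      cases n with
      | zero => exact fun i => i.elim0
      | succ m =>
        rw [Fin.strictMono_iff_lt_succ]
        intro i
        obtain ⟨h, h0, h1, h2⟩ := hr i (by omega)
        fin_cases c
        · exact h0
        · exact h1
        · exact h2
    · intro i c
      obtain ⟨h, h1, h2⟩ := hs i i.2
      fin_cases c
      · exact le_rfl
      · exact h1.le
      · exact h2.le
  · rintro ⟨hm, hl⟩
    have hlt : ∀ i c, c ≠ 0 → σ (shrubEquiv n (i, 0)) < σ (shrubEquiv n (i, c)) := by
      intro i c hc
      refine lt_of_le_of_ne (hl i c) fun h => hc ?_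
      simpa using h.symm
    constructor
    · intro i hi
      exact ⟨by omega, hlt ⟨i, hi⟩ 1 (by decide), hlt ⟨i, hi⟩ 2 (by decide)⟩
    · intro j hj
      have hj' : (⟨j, by omega⟩ : Fin n) < ⟨j + 1, by omega⟩ := by simp
      exact ⟨by omega, hm 0 hj', hm 1 hj', hm 2 hj'⟩

/-- The letter at `v` is the place, inside its shrub, of the position holding the value `v`. -/
def shrubWord {n : ℕ} (σ : Equiv.Perm (Fin (3 * n))) (v : Fin (3 * n)) : Fin 3 :=
  ((shrubEquiv n).symm (σ.symm v)).2

theorem shrubWord_apply {n : ℕ} (σ : Equiv.Perm (Fin (3 * n))) (i : Fin n) (c : Fin 3) :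
    shrubWord σ (σ (shrubEquiv n (i, c))) = c := by
  simp [shrubWord]

theorem filter_shrubWord_eq {n : ℕ} (σ : Equiv.Perm (Fin (3 * n))) (p : Fin (3 * n) → Prop)
    [DecidablePred p] (c : Fin 3) :
    (Finset.univ.filter fun v => p v ∧ shrubWord σ v = c).card =
      (Finset.univ.filter fun i => p (σ (shrubEquiv n (i, c)))).card := by
  symm
  refine Finset.card_bij (fun i _ => σ (shrubEquiv n (i, c))) ?_ ?_ ?_
  · intro i hi
    simpa [shrubWord_apply] using hi
  · intro i _ j _ h
    simpa using h
  · intro v hv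
    simp only [Finset.mem_filter, Finset.mem_univ, true_and] at hv
    obtain ⟨hp, rfl⟩ := hv
    have hv : σ (shrubEquiv n (((shrubEquiv n).symm (σ.symm v)).1, shrubWord σ v)) = v := by
      simp [shrubWord]
    exact ⟨_, by simpa [hv] using hp, hv⟩

/-- Comparing two increasing sequences termwise is the same as comparing how many of their terms
lie below any given bound. -/
theorem forall_le_iff_card_filter_le {α : Type*} [LinearOrder α] {n : ℕ} {a b : Fin n → α}
    (ha : StrictMono a) (hb : StrictMono b) :
    (∀ i, a i ≤ b i) ↔
      ∀ k, (Finset.univ.filter (b · ≤ k)).card ≤ (Finset.univ.filter (a · ≤ k)).card := by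
  constructor
  · intro h k
    refine Finset.card_le_card fun i hi => ?_
    simp only [Finset.mem_filter, Finset.mem_univ, true_and] at hi ⊢
    exact (h i).trans hi
  · intro h i
    by_contra! hlt
    have h1 : (Finset.Iic i).card ≤ (Finset.univ.filter (b · ≤ b i)).card :=
      Finset.card_le_card fun j hj => by simpa [hb.le_iff_le] using hj
    have h2 : (Finset.univ.filter (a · ≤ b i)).card ≤ (Finset.Iio i).card :=
      Finset.card_le_card fun j hj => by
        simp only [Finset.mem_filter, Finset.mem_univ, true_and] at hj
        simpa using ha.lt_iff_lt.1 (hj.trans_lt hlt)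
    have := h (b i)
    rw [Fin.card_Iic] at h1
    rw [Fin.card_Iio] at h2
    omega

theorem card_filter_shrubWord {n : ℕ} (σ : Equiv.Perm (Fin (3 * n))) (c : Fin 3) :
    (Finset.univ.filter (shrubWord σ · = c)).card = n := by
  simpa using filter_shrubWord_eq σ (fun _ => True) c

theorem shrubWord_mem_ballotWords_iff {n : ℕ} {σ : Equiv.Perm (Fin (3 * n))}
    (hm : ∀ c, StrictMono fun i => σ (shrubEquiv n (i, c))) :
    shrubWord σ ∈ ballotWords n ↔ σ ∈ shrubExtensions n := by
  simp only [ballotWords, mem_shrubExtensions, Finset.mem_filter, Finset.mem_univ, true_and,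
    card_filter_shrubWord, implies_true, hm, filter_shrubWord_eq σ (· ≤ _)]
  rw [forall_comm, forall_comm (α := Fin n)]
  exact forall_congr' fun c => (forall_le_iff_card_filter_le (hm 0) (hm c)).symm

theorem card_shrubExtensions (n : ℕ) : (shrubExtensions n).card = (ballotWords n).card := by
  refine Finset.card_bij (fun σ _ => shrubWord σ) ?_ ?_ ?_
  · intro σ hσ
    exact (shrubWord_mem_ballotWords_iff (mem_shrubExtensions.1 hσ).1).2 hσ
  · intro σ hσ τ hτ h
    have hσ := (mem_shrubExtensions.1 hσ).1
    have hτ := (mem_shrubExtensions.1 hτ).1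
    refine Equiv.ext fun v => ?_
    obtain ⟨⟨i, c⟩, rfl⟩ := (shrubEquiv n).surjective v
    have h1 := Finset.orderEmbOfFin_unique (card_filter_shrubWord σ c)
      (f := fun i => σ (shrubEquiv n (i, c))) (fun i => by simp [shrubWord_apply]) (hσ c)
    have h2 := Finset.orderEmbOfFin_unique (card_filter_shrubWord σ c)
      (f := fun i => τ (shrubEquiv n (i, c))) (fun i => by simp [h, shrubWord_apply]) (hτ c)
    exact congrFun (h1.trans h2.symm) i
  · intro f hf
    have hc := (Finset.mem_filter.1 hf).2.1
    let g : Fin n × Fin 3 → Fin (3 * n) := fun x =>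
      (Finset.univ.filter (f · = x.2)).orderEmbOfFin (hc x.2) x.1
    have hfg : ∀ x, f (g x) = x.2 := fun x =>
      (Finset.mem_filter.1 (Finset.orderEmbOfFin_mem _ (hc x.2) x.1)).2
    have hg : Function.Injective g := by
      rintro ⟨i, c⟩ ⟨j, d⟩ h
      obtain rfl : c = d := by simpa [hfg] using congrArg f h
      simpa [g] using h
    have hg' : Function.Bijective g :=
      (Fintype.bijective_iff_injective_and_card g).2 ⟨hg, by simp [mul_comm]⟩
    let σ : Equiv.Perm (Fin (3 * n)) := (shrubEquiv n).symm.trans (Equiv.ofBijective g hg')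
    have hσ : ∀ x, σ (shrubEquiv n x) = g x := fun x => by simp [σ]
    have hw : shrubWord σ = f := by
      funext v
      obtain ⟨⟨i, c⟩, rfl⟩ := hg'.surjective v
      rw [hfg, ← hσ, shrubWord_apply]
    refine ⟨σ, (shrubWord_mem_ballotWords_iff fun c => ?_).1 (hw ▸ hf), hw⟩
    simp only [hσ]
    exact (Finset.orderEmbOfFin _ (hc c)).strictMono

theorem ILF_eq_kreweras (n : ℕ) (hn : 1 ≤ n) : ILF n = (kreweras (3 * n)).card := by
  rw [card_kreweras, ← card_shrubExtensions]
  rfl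
end
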